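/- Suppose the decision-theoretic kernel p(W_V | F_A) obeys distributional consistency and the augmented DAG local Markov property for 𝒢* (modularity for decision diagrams). Then for every i ∈ V, every fully non-idle regime a ∈ 𝔛_A, and every v ∈ 𝔛_V such that p(W_{pre(i)} = v_{pre(i)} | F_A = a) > 0 and p(W_{pa(i)∩A} = a_{pa(i)∩A}, W_{pa(i)∖A} = v_{pa(i)∖A} | F_A = ∅) > 0: p(W_i = v_i | W_{pre(i)} = v_{pre(i)}, F_A = a) = p(W_i = v_i | W_{pa(i)∩A} = a_{pa(i)∩A}, W_{pa(i)∖A} = v_{pa(i)∖A}, F_A = ∅). Consequently p(W_V | F_A = a) is identified from the observational distribution p(W_V | F_A = ∅) whenever the observational conditional distributions on the right are well-defined. -/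

import Mathlib

open Finset

namespace CausalPaper

variable {V : Type*} [Fintype V] [LinearOrder V]
variable {𝔛 : V → Type*} [∀ i, Fintype (𝔛 i)]

/-- Probability of the event `E` under the distribution `q` on joint assignments. -/
noncomputable def pr (q : (∀ i, 𝔛 i) → ℝ) (E : (∀ i, 𝔛 i) → Prop) : ℝ :=
  ∑ v : (∀ i, 𝔛 i), Set.indicator (setOf E) q v

/-- Conditional probability of `E` given `F` under `q`. -/
noncomputable def cpr (q : (∀ i, 𝔛 i) → ℝ) (E F : (∀ i, 𝔛 i) → Prop) : ℝ :=
  pr q (fun v => E v ∧ F v) / pr q F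

/-- `q` is a probability distribution on joint assignments. -/
def IsProb (q : (∀ i, 𝔛 i) → ℝ) : Prop :=
  (∀ v, 0 ≤ q v) ∧ (∑ v : (∀ i, 𝔛 i), q v) = 1

/-- `v` agrees with `s` on the coordinates in `S`. -/
def agree (S : Finset V) (s v : ∀ i, 𝔛 i) : Prop :=
  ∀ i ∈ S, v i = s i

/-- The intervention/regime that sets the variables in `B` according to `b`
(and is idle elsewhere). -/
def setOn (B : Finset V) (b : ∀ i, 𝔛 i) : ∀ i, Option (𝔛 i) :=
  fun i => if i ∈ B then some (b i) else none

/-- The support of the partial intervention/regime `f` is contained in `A`. -/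
def suppIn (f : ∀ i, Option (𝔛 i)) (A : Finset V) : Prop :=
  ∀ i, f i ≠ none → i ∈ A

/-- Distributional consistency. -/
def DistConsistent (A : Finset V) (P : (∀ i, Option (𝔛 i)) → (∀ i, 𝔛 i) → ℝ) : Prop :=
  ∀ i ∈ A, ∀ C : Finset V, C ⊆ A \ {i} →
    ∀ (y : ∀ j, 𝔛 j) (b : 𝔛 i) (c : ∀ j, 𝔛 j),
      pr (P (Function.update (setOn C c) i (some b)))
          (fun v => agree (univ \ {i}) y v ∧ v i = b)
        = pr (P (setOn C c)) (fun v => agree (univ \ {i}) y v ∧ v i = b)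

/-- The predecessors of `i` under the total order on `V`. -/
def pre (i : V) : Finset V := univ.filter (fun j => j < i)

/-- The (SWIG / augmented-DAG) ordered local Markov property: under the regime
intervening on all of `A`, the conditional distribution of `X_i` given its
predecessors is a function only of `a` on `pa i ∩ A` and of `w` on `pa i \ A`. -/
def AugmentedLocalMarkov (A : Finset V) (pa : V → Finset V)
    (P : (∀ i, Option (𝔛 i)) → (∀ i, 𝔛 i) → ℝ) : Prop :=
  ∀ (i : V) (a a' w w' : ∀ j, 𝔛 j) (x : 𝔛 i),
    0 < pr (P (setOn A a)) (agree (pre i) w) →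
    0 < pr (P (setOn A a')) (agree (pre i) w') →
    (∀ j ∈ pa i ∩ A, a j = a' j) →
    (∀ j ∈ pa i \ A, w j = w' j) →
    cpr (P (setOn A a)) (fun v => v i = x) (agree (pre i) w)
      = cpr (P (setOn A a')) (fun v => v i = x) (agree (pre i) w')

/-- The ordinary ordered local Markov property for a single distribution `q`:
the conditional distribution of `X_i` given its predecessors is a function only
of the values of the parents. -/
def OrderedLocalMarkov (pa : V → Finset V) (q : (∀ i, 𝔛 i) → ℝ) : Prop :=
  ∀ (i : V) (w w' : ∀ j, 𝔛 j) (x : 𝔛 i),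
    0 < pr q (agree (pre i) w) →
    0 < pr q (agree (pre i) w') →
    (∀ j ∈ pa i, w j = w' j) →
    cpr q (fun v => v i = x) (agree (pre i) w)
      = cpr q (fun v => v i = x) (agree (pre i) w')

open Classical in
lemma pr_eq_sum_ite (q : (∀ i, 𝔛 i) → ℝ) (E : (∀ i, 𝔛 i) → Prop) :
    pr q E = ∑ v : (∀ i, 𝔛 i), if E v then q v else 0 := by
  simp only [pr, Set.indicator_apply]
  rfl

lemma pr_congr {q : (∀ i, 𝔛 i) → ℝ} {E F : (∀ i, 𝔛 i) → Prop} (h : ∀ v, E v ↔ F v) :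
    pr q E = pr q F := by
  rw [show E = F from funext fun v => propext (h v)]

lemma pr_nonneg {q : (∀ i, 𝔛 i) → ℝ} (hq : IsProb q) (E : (∀ i, 𝔛 i) → Prop) :
    0 ≤ pr q E :=
  sum_nonneg fun v _ => Set.indicator_nonneg (fun x _ => hq.1 x) v

lemma pr_mono {q : (∀ i, 𝔛 i) → ℝ} (hq : IsProb q) {E F : (∀ i, 𝔛 i) → Prop}
    (h : ∀ v, E v → F v) : pr q E ≤ pr q F :=
  sum_le_sum fun v _ =>
    Set.indicator_le_indicator_of_subset (s := {v | E v}) (t := {v | F v}) h (fun x => hq.1 x) v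

lemma pr_eq_of_iff_eq {q : (∀ i, 𝔛 i) → ℝ} {E : (∀ i, 𝔛 i) → Prop} {y : ∀ i, 𝔛 i}
    (h : ∀ v, E v ↔ v = y) : pr q E = q y := by
  classical
  simp [pr_eq_sum_ite, h]

lemma pr_agree_univ (q : (∀ i, 𝔛 i) → ℝ) (w : ∀ i, 𝔛 i) : pr q (agree univ w) = q w :=
  pr_eq_of_iff_eq fun v => by simp [agree, funext_iff]

lemma pr_agree_empty {q : (∀ i, 𝔛 i) → ℝ} (hq : IsProb q) (w : ∀ i, 𝔛 i) :
    pr q (agree ∅ w) = 1 := by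
  classical
  simpa [pr_eq_sum_ite, agree] using hq.2

omit [Fintype V] [∀ i, Fintype (𝔛 i)] in
lemma agree_insert_iff {m : V} {S : Finset V} {w v : ∀ i, 𝔛 i} :
    agree (insert m S) w v ↔ v m = w m ∧ agree S w v := by
  simp [agree]

lemma pr_agree_insert (q : (∀ i, 𝔛 i) → ℝ) (m : V) (S : Finset V) (w : ∀ i, 𝔛 i) :
    pr q (agree (insert m S) w) = pr q (fun v => v m = w m ∧ agree S w v) :=
  pr_congr fun _ => agree_insert_iff

omit [Fintype V] [∀ i, Fintype (𝔛 i)] in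
lemma agree_update_of_notMem {m : V} {S : Finset V} (hm : m ∉ S) (w v : ∀ i, 𝔛 i) (x : 𝔛 m) :
    agree S (Function.update w m x) v ↔ agree S w v := by
  refine forall₂_congr fun i hi => ?_
  rw [Function.update_of_ne (by rintro rfl; exact hm hi)]

/-- Marginalising out one coordinate. -/
lemma pr_agree_eq_sum_update (q : (∀ i, 𝔛 i) → ℝ) {m : V} {S : Finset V} (hm : m ∉ S)
    (w : ∀ i, 𝔛 i) :
    pr q (agree S w) = ∑ x : 𝔛 m, pr q (agree (insert m S) (Function.update w m x)) := by
  classical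
  simp only [pr_eq_sum_ite]
  rw [sum_comm]
  refine sum_congr rfl fun v _ => ?_
  simp only [agree_insert_iff, agree_update_of_notMem hm, Function.update_self, ite_and]
  simp

/-- Two functions whose sums over all cylinders based on `S` agree have the same total sum. -/
lemma sum_eq_of_pr_agree_eq {f g : (∀ i, 𝔛 i) → ℝ} (S : Finset V)
    (h : ∀ w, pr f (agree S w) = pr g (agree S w)) : ∑ v, f v = ∑ v, g v := by
  classical
  let r : (∀ i, 𝔛 i) → (∀ i : S, 𝔛 i) := fun v i => v i
  rw [← sum_fiberwise univ r f, ← sum_fiberwise univ r g]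
  refine sum_congr rfl fun b _ => ?_
  by_cases hb : ∃ w, r w = b
  · obtain ⟨w, rfl⟩ := hb
    have key : ∀ v, r v = r w ↔ agree S w v := fun v => by
      simp [r, agree, funext_iff]
    simpa only [pr_eq_sum_ite, sum_filter, key] using h w
  · have he : (univ.filter fun v => r v = b) = ∅ := by
      ext v
      simpa using fun hv => hb ⟨v, hv⟩
    rw [he]
    simp

/-- If `q (v i = x, w_S) = k * q (w_S)` for every `w` in an event `E` determined by the
coordinates in `S`, then the same holds with `E` in place of the cylinders. -/
lemma pr_and_eq_mul_of_agree {q : (∀ i, 𝔛 i) → ℝ} {F E : (∀ i, 𝔛 i) → Prop} (S : Finset V)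
    (hE : ∀ w v, agree S w v → (E v ↔ E w)) (k : ℝ)
    (h : ∀ w, E w → pr q (fun v => F v ∧ agree S w v) = k * pr q (agree S w)) :
    pr q (fun v => F v ∧ E v) = k * pr q E := by
  classical
  simp only [pr_eq_sum_ite, mul_sum]
  refine sum_eq_of_pr_agree_eq S fun w => ?_
  simp only [pr_eq_sum_ite]
  by_cases hw : E w
  · have := h w hw
    simp only [pr_eq_sum_ite, mul_sum] at this
    convert this using 1 <;> refine sum_congr rfl fun v _ => ?_ <;>
      by_cases hv : agree S w v <;> simp [hv, (hE w v · |>.2 hw)]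
  · refine sum_congr rfl fun v _ => ?_
    by_cases hv : agree S w v
    · simp [(hE w v hv).not.2 hw]
    · simp [hv]

lemma isProb_setOn {A : Finset V} {P : (∀ i, Option (𝔛 i)) → (∀ i, 𝔛 i) → ℝ}
    (hP : ∀ f, suppIn f A → IsProb (P f)) (a : ∀ i, 𝔛 i) : IsProb (P (setOn A a)) :=
  hP _ fun i hi => by
    by_contra h
    simp [setOn, h] at hi

lemma mem_pre {i j : V} : j ∈ pre i ↔ j < i := by simp [pre]

lemma notMem_pre_self (i : V) : i ∉ pre i := by simp [pre]

lemma isLowerSet_pre (i : V) : IsLowerSet (pre i : Set V) := fun _ _ hba ha =>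
  mem_coe.2 (mem_pre.2 (hba.trans_lt (mem_pre.1 (mem_coe.1 ha))))

lemma isLowerSet_insert_pre (i : V) : IsLowerSet ((insert i (pre i) : Finset V) : Set V) := by
  intro a b hba ha
  simp only [coe_insert, Set.mem_insert_iff, mem_coe, mem_pre, ← le_iff_eq_or_lt] at ha ⊢
  exact hba.trans ha

/-- Induction on initial segments of the order. -/
lemma lowerSet_induction {p : Finset V → Prop} (empty : p ∅)
    (step : ∀ m, p (pre m) → p (insert m (pre m))) (S : Finset V)
    (hS : IsLowerSet (S : Set V)) : p S := by
  induction S using Finset.induction_on_max with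
  | empty => exact empty
  | insert m S hmax ih =>
    have hpre : S = pre m := by
      ext j
      refine ⟨fun hj => mem_pre.2 (hmax j hj), fun hj => ?_⟩
      have hlt := mem_pre.1 hj
      have := hS hlt.le (by simp)
      simpa [hlt.ne] using this
    subst hpre
    exact step m (ih (isLowerSet_pre m))

/-- Downward induction on initial segments of the order. -/
lemma lowerSet_induction_down {p : Finset V → Prop} (top : p univ)
    (step : ∀ m, p (insert m (pre m)) → p (pre m)) (S : Finset V)
    (hS : IsLowerSet (S : Set V)) : p S := by
  induction h : Sᶜ.card using Nat.strong_induction_on generalizing S with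
  | _ n ih =>
    by_cases hne : Sᶜ.Nonempty
    · have hm := min'_mem _ hne
      set m := Sᶜ.min' hne
      have hpre : S = pre m := by
        ext j
        rw [mem_pre]
        constructor
        · intro hj
          by_contra hlt
          exact mem_compl.1 hm (hS (not_lt.1 hlt) hj)
        · intro hj
          by_contra hjS
          exact absurd (min'_le _ j (mem_compl.2 hjS)) (not_le.2 hj)
      have hlow : IsLowerSet ((insert m S : Finset V) : Set V) :=
        hpre ▸ isLowerSet_insert_pre m
      have hcard : (insert m S)ᶜ.card < n := by
        rw [← h]
        exact card_lt_card (compl_ssubset_compl.2 (ssubset_insert (mem_compl.1 hm)))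
      have hins := ih _ hcard _ hlow rfl
      rw [hpre] at hins ⊢
      exact step m hins
    · rw [not_nonempty_iff_eq_empty, compl_eq_empty_iff] at hne
      rw [hne]
      exact top

/-- The chain rule step, valid also when the conditioning event is null. -/
lemma pr_agree_insert_eq_cpr_mul {q : (∀ i, 𝔛 i) → ℝ} (hq : IsProb q) (m : V) (S : Finset V)
    (w : ∀ i, 𝔛 i) :
    pr q (agree (insert m S) w)
      = cpr q (fun v => v m = w m) (agree S w) * pr q (agree S w) := by
  rw [pr_agree_insert, cpr]
  by_cases h : pr q (agree S w) = 0
  · rw [h, mul_zero]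
    exact le_antisymm (h ▸ pr_mono hq fun v hv => hv.2) (pr_nonneg hq _)
  · rw [div_mul_cancel₀ _ h]

section Kernel

variable {A : Finset V} {pa : V → Finset V} {P : (∀ i, Option (𝔛 i)) → (∀ i, 𝔛 i) → ℝ}

/-- The law of an initial segment is unaffected by interventions on variables that
precede none of its members. -/
lemma pr_setOn_agree_congr (hpa : ∀ i, pa i ⊆ pre i) (hP : ∀ f, suppIn f A → IsProb (P f))
    (hM : AugmentedLocalMarkov A pa P) (a a' w : ∀ i, 𝔛 i) (S : Finset V)
    (hS : IsLowerSet (S : Set V)) (h : ∀ j ∈ S, ∀ k < j, a k = a' k) :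
    pr (P (setOn A a)) (agree S w) = pr (P (setOn A a')) (agree S w) := by
  have hq := isProb_setOn hP a
  have hq' := isProb_setOn hP a'
  revert h
  refine lowerSet_induction (p := fun S => (∀ j ∈ S, ∀ k < j, a k = a' k) →
    pr (P (setOn A a)) (agree S w) = pr (P (setOn A a')) (agree S w)) ?_ ?_ S hS
  · intro _
    rw [pr_agree_empty hq, pr_agree_empty hq']
  · intro m ih h
    have hpre := ih fun j hj => h j (mem_insert_of_mem hj)
    rw [pr_agree_insert_eq_cpr_mul hq, pr_agree_insert_eq_cpr_mul hq', ← hpre]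
    rcases (pr_nonneg hq (agree (pre m) w)).eq_or_lt with h0 | h0
    · simp [← h0]
    · rw [hM m a a' w w (w m) h0 (hpre ▸ h0)
        (fun j hj => h m (mem_insert_self _ _) j (mem_pre.1 (hpa m (mem_inter.1 hj).1)))
        fun _ _ => rfl]

/-- Consistency at full assignments: intervening on `C` with the values of `w` does not
change the probability of `w`. -/
lemma DistConsistent.setOn_apply_self (hDC : DistConsistent A P) (w : ∀ i, 𝔛 i) (C : Finset V)
    (hC : C ⊆ A) : P (setOn C w) w = P (fun _ => none) w := by
  induction C using Finset.induction_on with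
  | empty => rw [show setOn ∅ w = fun _ => none from funext fun j => by simp [setOn]]
  | insert i C hi ih =>
    rw [← ih ((subset_insert i C).trans hC)]
    have hsub : C ⊆ A \ {i} := fun j hj =>
      mem_sdiff.2 ⟨hC (mem_insert_of_mem hj), by simpa using fun h : j = i => hi (h ▸ hj)⟩
    have key : ∀ v : ∀ j, 𝔛 j, (agree (univ \ {i}) w v ∧ v i = w i) ↔ v = w := fun v => by
      refine ⟨fun hv => funext fun j => ?_, by rintro rfl; simp [agree]⟩
      by_cases hj : j = i
      · subst hj; exact hv.2
      · exact hv.1 j (by simp [hj])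
    have := hDC i (hC (mem_insert_self i C)) C hsub w (w i) w
    rw [pr_eq_of_iff_eq key, pr_eq_of_iff_eq key] at this
    rw [← this]
    congr 1
    funext j
    by_cases hj : j = i
    · subst hj; simp [setOn]
    · simp [setOn, hj]

/-- The observational law of an initial segment at `w` is its law in the regime set to `w`. -/
lemma pr_idle_agree_eq (hpa : ∀ i, pa i ⊆ pre i) (hP : ∀ f, suppIn f A → IsProb (P f))
    (hDC : DistConsistent A P) (hM : AugmentedLocalMarkov A pa P) (w : ∀ i, 𝔛 i)
    (S : Finset V) (hS : IsLowerSet (S : Set V)) :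
    pr (P (fun _ => none)) (agree S w) = pr (P (setOn A w)) (agree S w) := by
  refine lowerSet_induction_down (p := fun S => ∀ w : ∀ i, 𝔛 i,
    pr (P (fun _ => none)) (agree S w) = pr (P (setOn A w)) (agree S w)) ?_ ?_ S hS w
  · intro w
    rw [pr_agree_univ, pr_agree_univ, hDC.setOn_apply_self w A subset_rfl]
  · intro m ih w
    rw [pr_agree_eq_sum_update _ (notMem_pre_self m),
      pr_agree_eq_sum_update _ (notMem_pre_self m)]
    refine sum_congr rfl fun x _ => ?_
    rw [ih]
    refine pr_setOn_agree_congr hpa hP hM _ _ _ _ (isLowerSet_insert_pre m) fun j hj k hk => ?_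
    refine Function.update_of_ne (ne_of_lt (hk.trans_le ?_)) _ _
    rcases mem_insert.1 hj with rfl | hj
    · exact le_rfl
    · exact (mem_pre.1 hj).le

/-- Kernel modularity. -/
lemma cpr_setOn_eq_cpr_idle (hpa : ∀ i, pa i ⊆ pre i) (hP : ∀ f, suppIn f A → IsProb (P f))
    (hDC : DistConsistent A P) (hM : AugmentedLocalMarkov A pa P) (i : V) (a v : ∀ j, 𝔛 j)
    (ha : 0 < pr (P (setOn A a)) (agree (pre i) v))
    (ho : 0 < pr (P (fun _ => none))
      (fun u => agree (pa i ∩ A) a u ∧ agree (pa i \ A) v u)) :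
    cpr (P (setOn A a)) (fun u => u i = v i) (agree (pre i) v)
      = cpr (P (fun _ => none)) (fun u => u i = v i)
          (fun u => agree (pa i ∩ A) a u ∧ agree (pa i \ A) v u) := by
  rw [cpr.eq_1 (P fun _ => none), eq_div_iff ho.ne']
  symm
  refine pr_and_eq_mul_of_agree (pre i) ?_ _ ?_
  · intro w u hu
    refine and_congr (forall₂_congr fun j hj => ?_) (forall₂_congr fun j hj => ?_)
    · rw [hu j (hpa i (mem_inter.1 hj).1)]
    · rw [hu j (hpa i (mem_sdiff.1 hj).1)]
  · rintro w ⟨hwa, hwv⟩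
    have hq := isProb_setOn hP w
    set w' := Function.update w i (v i) with hw'
    have hjoint : pr (P fun _ => none) (fun u => u i = v i ∧ agree (pre i) w u)
        = pr (P (setOn A w)) (fun u => u i = v i ∧ agree (pre i) w u) := by
      have hev : ∀ u, (u i = v i ∧ agree (pre i) w u) ↔ agree (insert i (pre i)) w' u :=
        fun u => by
          rw [agree_insert_iff, hw', agree_update_of_notMem (notMem_pre_self i),
            Function.update_self]
      rw [pr_congr hev, pr_congr hev,
        pr_idle_agree_eq hpa hP hDC hM _ _ (isLowerSet_insert_pre i)]
      refine pr_setOn_agree_congr hpa hP hM _ _ _ _ (isLowerSet_insert_pre i)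
        fun j hj k hk => ?_
      refine Function.update_of_ne (ne_of_lt (hk.trans_le ?_)) _ _
      rcases mem_insert.1 hj with rfl | hj
      · exact le_rfl
      · exact (mem_pre.1 hj).le
    rw [hjoint, pr_idle_agree_eq hpa hP hDC hM _ _ (isLowerSet_pre i)]
    rcases (pr_nonneg hq (agree (pre i) w)).eq_or_lt with h0 | h0
    · rw [← h0, mul_zero]
      exact le_antisymm (h0 ▸ pr_mono hq fun u hu => hu.2) (pr_nonneg hq _)
    · rw [hM i a w v w (v i) ha h0 (fun j hj => (hwa j hj).symm) (fun j hj => (hwv j hj).symm),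
        cpr, div_mul_cancel₀ _ h0.ne']

end Kernel

/-- Kernel modularity and identification: each interventional conditional equals the
corresponding observational conditional given the parents, and `p(W_V | F_A = a)` is
given by the g-formula whenever the observational conditioning events are positive. -/
theorem stmt15_kernel_identification
    (A : Finset V) (hA : A ⊆ univ)
    (pa : V → Finset V) (hpa : ∀ i, pa i ⊆ pre i)
    (P : (∀ i, Option (𝔛 i)) → (∀ i, 𝔛 i) → ℝ)
    (hP : ∀ f, suppIn f A → IsProb (P f))
    (hDC : DistConsistent A P)
    (hM : AugmentedLocalMarkov A pa P) :
    (∀ (i : V) (a v : ∀ j, 𝔛 j),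
      0 < pr (P (setOn A a)) (agree (pre i) v) →
      0 < pr (P (fun _ => none))
            (fun u => agree (pa i ∩ A) a u ∧ agree (pa i \ A) v u) →
      cpr (P (setOn A a)) (fun u => u i = v i) (agree (pre i) v)
        = cpr (P (fun _ => none)) (fun u => u i = v i)
            (fun u => agree (pa i ∩ A) a u ∧ agree (pa i \ A) v u)) ∧
    (∀ (a v : ∀ j, 𝔛 j),
      (∀ i : V, 0 < pr (P (fun _ => none))
          (fun u => agree (pa i ∩ A) a u ∧ agree (pa i \ A) v u)) →
      P (setOn A a) v
        = ∏ i : V, cpr (P (fun _ => none)) (fun u => u i = v i)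
            (fun u => agree (pa i ∩ A) a u ∧ agree (pa i \ A) v u)) := by
  have hmod := cpr_setOn_eq_cpr_idle hpa hP hDC hM
  refine ⟨hmod, fun a v hpos => ?_⟩
  have hq := isProb_setOn hP a
  rw [← pr_agree_univ (P (setOn A a)) v]
  refine lowerSet_induction (p := fun S => pr (P (setOn A a)) (agree S v)
    = ∏ i ∈ S, cpr (P (fun _ => none)) (fun u => u i = v i)
      (fun u => agree (pa i ∩ A) a u ∧ agree (pa i \ A) v u)) ?_ ?_ univ (by simp [isLowerSet_univ])
  · rw [pr_agree_empty hq, prod_empty]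
  · intro m ih
    rw [prod_insert (notMem_pre_self m), ← ih, pr_agree_insert_eq_cpr_mul hq]
    rcases (pr_nonneg hq (agree (pre m) v)).eq_or_lt with h0 | h0
    · rw [← h0, mul_zero, mul_zero]
    · rw [hmod m a v h0 (hpos m)]

end CausalPaper
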